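/- Let p : [-π, π] → ℝ≥0 be a probability density function and let α > 1 satisfy ∫_{-π}^{π} p(φ)^α dφ < ∞. For each d ∈ ℕ₊ let T_p⁽ᵈ⁾ be the d × d positive semidefinite matrix with entries (T_p)_{hk} = ∫_{-π}^{π} p(φ) e^{-i(h-k)φ} dφ, and let λ₁, …, λ_d be its eigenvalues. Then lim_{d→∞} (1/d) Σ_{j=1}^{d} λ_j^α = (2π)^{α−1} ∫_{-π}^{π} p(φ)^α dφ. Consequently, lim_{d→∞} (1/(α−1)) log₂( (1/d) Tr[(T_p⁽ᵈ⁾)^α] ) = log₂(2π) + (1/(α−1)) log₂ ∫_{-π}^{π} p(φ)^α dφ = D_α(p‖u), the α-Rényi divergence of p from the uniform density on [-π, π]. -/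

import Mathlib

open scoped Real ComplexOrder
open MeasureTheory Filter AddCircle
open scoped ENNReal ComplexConjugate Matrix

section

/-- The tangent line inequality for the convex function `x ↦ x ^ α` on `[0, ∞)`. -/
theorem rpow_add_mul_sub_le_rpow {α x a : ℝ} (hα : 1 < α) (hx : 0 ≤ x) (ha : 0 ≤ a) :
    a ^ α + α * a ^ (α - 1) * (x - a) ≤ x ^ α := by
  rcases ha.eq_or_lt with rfl | ha
  · rw [Real.zero_rpow (by linarith), Real.zero_rpow (by linarith)]
    simpa using Real.rpow_nonneg hx α
  · have h := one_add_mul_self_le_rpow_one_add (s := x / a - 1) (p := α)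
      (by have := div_nonneg hx ha.le; linarith) hα.le
    rw [add_sub_cancel, Real.div_rpow hx ha.le, le_div_iff₀ (Real.rpow_pos_of_pos ha α)] at h
    refine le_trans (le_of_eq ?_) h
    rw [Real.rpow_sub_one ha.ne']
    field_simp

variable {T : ℝ} [hT : Fact (0 < T)]

theorem integral_fourier (n : ℤ) :
    ∫ x : AddCircle T, fourier n x ∂haarAddCircle = if n = 0 then 1 else 0 := by
  have h := congrFun (fourierCoeff_fourier (T := T) n) 0
  rw [fourierCoeff] at h
  simp only [neg_zero, fourier_zero, one_smul] at h
  rw [h, Pi.single_apply]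
  simp only [eq_comm]

/-- Number of index pairs on the `n`-th diagonal of a `d × d` matrix, divided by `d`, tends to 1. -/
theorem tendsto_card_diagonal_div (n : ℤ) :
    Tendsto (fun d : ℕ => (1 / (d : ℝ)) *
      ∑ h : Fin d, ∑ k : Fin d, if n + ((h : ℤ) - (k : ℤ)) = 0 then (1 : ℝ) else 0)
      atTop (nhds 1) := by
  have key : ∀ d : ℕ, n.natAbs ≤ d →
      ∑ h : Fin d, ∑ k : Fin d, (if n + ((h : ℤ) - (k : ℤ)) = 0 then (1 : ℝ) else 0)
        = d - n.natAbs := by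
    intro d hd
    have h1 : ∀ h : Fin d,
        ∑ k : Fin d, (if n + ((h : ℤ) - (k : ℤ)) = 0 then (1 : ℝ) else 0)
          = if (0 ≤ n + (h : ℕ) ∧ n + (h : ℕ) < d) then 1 else 0 := by
      intro h
      split_ifs with hh
      · rw [Finset.sum_eq_single (⟨(n + (h : ℕ)).toNat, by omega⟩ : Fin d)]
        · rw [if_pos]
          simp only
          omega
        · intro b _ hb
          rw [if_neg]
          intro hc
          apply hb
          ext
          simp only
          omega
        · simp
      · apply Finset.sum_eq_zero
        intro k _
        rw [if_neg]
        omega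
    rw [Finset.sum_congr rfl fun h _ => h1 h,
      Fin.sum_univ_eq_sum_range (fun h : ℕ =>
        if (0 ≤ n + (h : ℤ) ∧ n + (h : ℤ) < d) then (1 : ℝ) else 0) d,
      Finset.sum_boole]
    have h2 : (Finset.range d).filter (fun h : ℕ => 0 ≤ n + (h : ℤ) ∧ n + (h : ℤ) < d)
        = Finset.Ico (-n).toNat (min d (d - n).toNat) := by
      ext h
      simp only [Finset.mem_filter, Finset.mem_range, Finset.mem_Ico]
      omega
    rw [h2, Nat.card_Ico, ← Nat.cast_sub hd]
    congr 1
    omega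
  have hlim : Tendsto (fun d : ℕ => 1 - (n.natAbs : ℝ) / (d : ℝ)) atTop (nhds 1) := by
    simpa using (tendsto_const_div_atTop_nhds_zero_nat (n.natAbs : ℝ)).const_sub 1
  refine hlim.congr' ?_
  filter_upwards [eventually_ge_atTop n.natAbs, eventually_gt_atTop 0] with d hd hd0
  rw [key d hd]
  have : (d : ℝ) ≠ 0 := by positivity
  field_simp

/-- A sequence bounded in `L^p` whose Fourier coefficients all tend to zero tends to zero weakly
against `L^q`. -/
theorem tendsto_integral_mul_of_tendsto_fourier {p q : ℝ≥0∞} [q.HolderConjugate p] (hq : q ≠ ∞)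
    {W : ℕ → AddCircle T → ℂ} (hW : ∀ d, MemLp (W d) p haarAddCircle) {C : ℝ≥0∞} (hCtop : C ≠ ∞)
    (hC : ∀ d, eLpNorm (W d) p haarAddCircle ≤ C)
    (h : ∀ n : ℤ, Tendsto (fun d => ∫ x, fourier n x * W d x ∂haarAddCircle) atTop (nhds 0))
    {g : AddCircle T → ℂ} (hg : MemLp g q haarAddCircle) :
    Tendsto (fun d => ∫ x, g x * W d x ∂haarAddCircle) atTop (nhds 0) := by
  have : Fact (1 ≤ q) := ⟨ENNReal.HolderConjugate.one_le q p⟩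
  have hint : ∀ (f : Lp ℂ q (haarAddCircle (T := T))) (d : ℕ),
      Integrable (fun x => f x * W d x) haarAddCircle := fun f d =>
    (Lp.memLp f).integrable_mul (hW d)
  have hbound : ∀ (f : Lp ℂ q (haarAddCircle (T := T))) (d : ℕ),
      ‖∫ x, f x * W d x ∂haarAddCircle‖ ≤ ‖f‖ * C.toReal := by
    intro f d
    have h1 := enorm_integral_le_lintegral_enorm (μ := haarAddCircle) (fun x => f x * W d x)
    have h2 : eLpNorm ((f : AddCircle T → ℂ) • W d) 1 haarAddCircle
        ≤ eLpNorm f q haarAddCircle * eLpNorm (W d) p haarAddCircle :=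
      eLpNorm_smul_le_mul_eLpNorm (hW d).1 (Lp.memLp f).1
    rw [eLpNorm_one_eq_lintegral_enorm] at h2
    have h3 := (h1.trans h2).trans (mul_le_mul_right (hC d) _)
    rw [← Lp.enorm_def] at h3
    have h4 := ENNReal.toReal_mono (ENNReal.mul_ne_top (by simp) hCtop) h3
    simpa [ENNReal.toReal_mul] using h4
  have hspan : ∀ f ∈ Submodule.span ℂ (Set.range (@fourierLp T _ q _)),
      Tendsto (fun d => ∫ x, f x * W d x ∂haarAddCircle) atTop (nhds 0) := by
    intro f hf
    induction hf using Submodule.span_induction with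
    | mem f hf =>
      obtain ⟨n, rfl⟩ := hf
      refine (h n).congr fun d => integral_congr_ae ?_
      filter_upwards [coeFn_fourierLp q n] with x hx
      rw [hx]
    | zero =>
      refine tendsto_const_nhds.congr fun d => ?_
      rw [integral_eq_zero_of_ae]
      filter_upwards [Lp.coeFn_zero ℂ q haarAddCircle] with x hx
      simp
    | add f g _ _ hf hg =>
      have := hf.add hg
      rw [add_zero] at this
      refine this.congr fun d => ?_
      rw [← integral_add (hint f d) (hint g d)]
      refine integral_congr_ae ?_
      filter_upwards [Lp.coeFn_add f g] with x hx
      rw [hx, Pi.add_apply, add_mul]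
    | smul c f _ hf =>
      have := hf.const_mul c
      rw [mul_zero] at this
      refine this.congr fun d => ?_
      rw [← integral_const_mul]
      refine integral_congr_ae ?_
      filter_upwards [Lp.coeFn_smul c f] with x hx
      rw [hx, Pi.smul_apply, smul_eq_mul, mul_assoc]
  have hgG : ∀ d, ∫ x, hg.toLp g x * W d x ∂haarAddCircle = ∫ x, g x * W d x ∂haarAddCircle := by
    intro d
    refine integral_congr_ae ?_
    filter_upwards [hg.coeFn_toLp] with x hx
    rw [hx]
  have hmem : hg.toLp g ∈ closure
      (Submodule.span ℂ (Set.range (@fourierLp T _ q _)) : Set (Lp ℂ q haarAddCircle)) := by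
    rw [← Submodule.topologicalClosure_coe, span_fourierLp_closure_eq_top hq]
    trivial
  rw [Metric.tendsto_atTop]
  intro ε hε
  obtain ⟨P, hP, hPd⟩ := Metric.mem_closure_iff.1 hmem (ε / 2 / (C.toReal + 1)) (by positivity)
  obtain ⟨N, hN⟩ := Metric.tendsto_atTop.1 (hspan P hP) (ε / 2) (by positivity)
  refine ⟨N, fun d hd => ?_⟩
  have h1 := hbound (hg.toLp g - P) d
  have h2 : ∫ x, (hg.toLp g - P : Lp ℂ q haarAddCircle) x * W d x ∂haarAddCircle
      = ∫ x, g x * W d x ∂haarAddCircle - ∫ x, P x * W d x ∂haarAddCircle := by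
    rw [← hgG, ← integral_sub (hint _ d) (hint _ d)]
    refine integral_congr_ae ?_
    filter_upwards [Lp.coeFn_sub (hg.toLp g) P] with x hx
    rw [hx, Pi.sub_apply, sub_mul]
  have h3 := hN d hd
  rw [dist_zero_right] at h3 ⊢
  rw [dist_eq_norm, lt_div_iff₀ (by positivity)] at hPd
  rw [h2] at h1
  have h4 := norm_le_norm_sub_add (∫ x, g x * W d x ∂haarAddCircle)
    (∫ x, P x * W d x ∂haarAddCircle)
  nlinarith [norm_nonneg (hg.toLp g - P)]

end

section

variable {T : ℝ} {d : ℕ}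

/-- The trigonometric polynomial with coefficients `v`. -/
noncomputable def trigPoly (v : Fin d → ℂ) (x : AddCircle T) : ℂ :=
  ∑ k : Fin d, v k * fourier ((k : ℕ) : ℤ) x

theorem continuous_trigPoly (v : Fin d → ℂ) : Continuous (trigPoly v : AddCircle T → ℂ) := by
  unfold trigPoly
  fun_prop

theorem fourier_mul_conj_fourier (m n : ℤ) (x : AddCircle T) :
    fourier m x * conj (fourier n x) = fourier (m - n) x := by
  rw [← fourier_neg, ← fourier_add, sub_eq_add_neg]

theorem norm_trigPoly_sq (v : Fin d → ℂ) (x : AddCircle T) :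
    ((‖trigPoly v x‖ ^ 2 : ℝ) : ℂ) =
      ∑ h : Fin d, ∑ k : Fin d, v h * conj (v k) * fourier (((h : ℕ) : ℤ) - ((k : ℕ) : ℤ)) x := by
  rw [Complex.ofReal_pow, ← Complex.mul_conj', trigPoly, map_sum, Finset.sum_mul_sum]
  refine Finset.sum_congr rfl fun h _ => Finset.sum_congr rfl fun k _ => ?_
  rw [← fourier_mul_conj_fourier, map_mul]
  ring

theorem sum_norm_trigPoly_sq (b : OrthonormalBasis (Fin d) ℂ (EuclideanSpace ℂ (Fin d)))
    (x : AddCircle T) : ∑ j, ‖trigPoly (b j) x‖ ^ 2 = d := by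
  have h := b.sum_sq_norm_inner_left
    (WithLp.toLp 2 fun k : Fin d => conj (fourier ((k : ℕ) : ℤ) x))
  rw [EuclideanSpace.norm_sq_eq] at h
  simp only [PiLp.inner_apply, RCLike.inner_apply, Complex.conj_conj, RCLike.norm_conj] at h
  have hn : ∀ n : ℤ, ‖fourier n x‖ = 1 := fun n => Circle.norm_coe _
  simp only [hn, one_pow, Finset.sum_const, Finset.card_univ, Fintype.card_fin, nsmul_eq_mul,
    mul_one] at h
  exact h

/-- The lower (Berezin) symbol of a Hermitian matrix `A`, written in an eigenbasis of `A`; for a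
Toeplitz matrix it is the Fejér mean of the symbol. -/
noncomputable def lowerSymbol {A : Matrix (Fin d) (Fin d) ℂ} (hH : A.IsHermitian)
    (x : AddCircle T) : ℝ :=
  (1 / (d : ℝ)) * ∑ j, hH.eigenvalues j * ‖trigPoly (hH.eigenvectorBasis j) x‖ ^ 2

theorem continuous_lowerSymbol {A : Matrix (Fin d) (Fin d) ℂ} (hH : A.IsHermitian) :
    Continuous (lowerSymbol hH : AddCircle T → ℝ) :=
  continuous_const.mul (continuous_finsetSum _ fun _ _ =>
    continuous_const.mul ((continuous_trigPoly _).norm.pow 2))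

theorem lowerSymbol_nonneg {A : Matrix (Fin d) (Fin d) ℂ} (hP : A.PosSemidef) (x : AddCircle T) :
    0 ≤ lowerSymbol hP.isHermitian x :=
  mul_nonneg (by positivity) (Finset.sum_nonneg fun j _ =>
    mul_nonneg (hP.eigenvalues_nonneg j) (by positivity))

theorem sum_eigenvalues_mul {A : Matrix (Fin d) (Fin d) ℂ} (hH : A.IsHermitian) (h k : Fin d) :
    ∑ j, (hH.eigenvalues j : ℂ) * (hH.eigenvectorBasis j h * conj (hH.eigenvectorBasis j k))
      = A h k := by
  conv_rhs => rw [hH.spectral_theorem]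
  rw [Unitary.conjStarAlgAut_apply, Matrix.mul_apply]
  refine Finset.sum_congr rfl fun j _ => ?_
  rw [Matrix.mul_diagonal, Matrix.star_apply, Matrix.IsHermitian.eigenvectorUnitary_apply,
    Matrix.IsHermitian.eigenvectorUnitary_apply]
  simp only [Function.comp_apply, RCLike.star_def, Complex.coe_algebraMap]
  ring

theorem lowerSymbol_eq {A : Matrix (Fin d) (Fin d) ℂ} (hH : A.IsHermitian) (x : AddCircle T) :
    (lowerSymbol hH x : ℂ) = (1 / (d : ℂ)) * ∑ h : Fin d, ∑ k : Fin d,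
      A h k * fourier (((h : ℕ) : ℤ) - ((k : ℕ) : ℤ)) x := by
  rw [lowerSymbol, Complex.ofReal_mul, Complex.ofReal_sum]
  congr 1
  · simp
  simp_rw [Complex.ofReal_mul, norm_trigPoly_sq, ← sum_eigenvalues_mul hH, Finset.mul_sum,
    Finset.sum_mul]
  rw [Finset.sum_comm]
  refine Finset.sum_congr rfl fun h _ => ?_
  rw [Finset.sum_comm]
  exact Finset.sum_congr rfl fun k _ => Finset.sum_congr rfl fun j _ => by ring

variable [hT : Fact (0 < T)]

theorem integrable_fourier (n : ℤ) : Integrable (fun x : AddCircle T => fourier n x) haarAddCircle :=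
  (fourier n).continuous.integrable_of_hasCompactSupport (HasCompactSupport.of_compactSpace _)

theorem integral_norm_trigPoly_sq (v : Fin d → ℂ) :
    ∫ x : AddCircle T, ‖trigPoly v x‖ ^ 2 ∂haarAddCircle = ∑ k, ‖v k‖ ^ 2 := by
  rw [← Complex.ofReal_inj, ← integral_complex_ofReal]
  simp_rw [norm_trigPoly_sq]
  rw [integral_finsetSum _ fun h _ => integrable_finsetSum _ fun k _ =>
    (integrable_fourier _).const_mul _, Complex.ofReal_sum]
  refine Finset.sum_congr rfl fun h _ => ?_
  rw [integral_finsetSum _ fun k _ => (integrable_fourier _).const_mul _]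
  simp_rw [integral_const_mul, integral_fourier, sub_eq_zero, Nat.cast_inj, Fin.val_inj]
  simp [Complex.mul_conj']

theorem fourierCoeff_neg_eq_integral (F : AddCircle T → ℂ) (n : ℤ) :
    fourierCoeff F (-n) = ∫ x, fourier n x * F x ∂haarAddCircle := by
  simp [fourierCoeff]

theorem Integrable.fourier_mul {F : AddCircle T → ℂ} (hF : Integrable F haarAddCircle) (n : ℤ) :
    Integrable (fun x => fourier n x * F x) haarAddCircle := by
  simpa using hF.fourier_smul n

/-- The quadratic form of the Toeplitz matrix of the symbol `F`. -/
theorem dotProduct_toeplitz_mulVec {A : Matrix (Fin d) (Fin d) ℂ} {F : AddCircle T → ℝ}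
    (hF : Integrable F haarAddCircle)
    (hA : ∀ h k : Fin d, A h k =
      fourierCoeff (fun x => (F x : ℂ)) (((h : ℕ) : ℤ) - ((k : ℕ) : ℤ))) (v : Fin d → ℂ) :
    star v ⬝ᵥ (A *ᵥ v) = ((∫ x, F x * ‖trigPoly v x‖ ^ 2 ∂haarAddCircle : ℝ) : ℂ) := by
  have hi : ∀ h k : Fin d, Integrable (fun x => v h * conj (v k) *
      (fourier (((h : ℕ) : ℤ) - ((k : ℕ) : ℤ)) x * (F x : ℂ))) haarAddCircle := fun h k =>
    (Integrable.fourier_mul hF.ofReal _).const_mul _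
  rw [← integral_complex_ofReal]
  have : ∀ x, ((F x * ‖trigPoly v x‖ ^ 2 : ℝ) : ℂ) = ∑ h : Fin d, ∑ k : Fin d, v h * conj (v k) *
      (fourier (((h : ℕ) : ℤ) - ((k : ℕ) : ℤ)) x * (F x : ℂ)) := by
    intro x
    rw [Complex.ofReal_mul, norm_trigPoly_sq, Finset.mul_sum]
    refine Finset.sum_congr rfl fun h _ => ?_
    rw [Finset.mul_sum]
    exact Finset.sum_congr rfl fun k _ => by ring
  simp_rw [this]
  rw [integral_finsetSum _ fun h _ => integrable_finsetSum _ fun k _ => hi h k]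
  simp_rw [integral_finsetSum _ fun k _ => hi _ k, integral_const_mul,
    ← fourierCoeff_neg_eq_integral, neg_sub, ← hA]
  simp only [dotProduct, Matrix.mulVec, Pi.star_apply, Finset.mul_sum]
  rw [Finset.sum_comm]
  exact Finset.sum_congr rfl fun h _ => Finset.sum_congr rfl fun k _ => by
    simp only [RCLike.star_def]; ring

theorem eigenvalues_eq_integral {A : Matrix (Fin d) (Fin d) ℂ} (hH : A.IsHermitian)
    {F : AddCircle T → ℝ} (hF : Integrable F haarAddCircle)
    (hA : ∀ h k : Fin d, A h k =
      fourierCoeff (fun x => (F x : ℂ)) (((h : ℕ) : ℤ) - ((k : ℕ) : ℤ))) (j : Fin d) :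
    hH.eigenvalues j = ∫ x, F x * ‖trigPoly (hH.eigenvectorBasis j) x‖ ^ 2 ∂haarAddCircle := by
  rw [hH.eigenvalues_eq, dotProduct_toeplitz_mulVec hF hA]
  simp

theorem integral_norm_trigPoly_orthonormalBasis_sq
    (b : OrthonormalBasis (Fin d) ℂ (EuclideanSpace ℂ (Fin d))) (j : Fin d) :
    ∫ x : AddCircle T, ‖trigPoly (b j) x‖ ^ 2 ∂haarAddCircle = 1 := by
  rw [integral_norm_trigPoly_sq, ← EuclideanSpace.norm_sq_eq, b.norm_eq_one, one_pow]

theorem integral_fourier_mul_lowerSymbol {A : Matrix (Fin d) (Fin d) ℂ} (hH : A.IsHermitian)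
    {c : ℤ → ℂ} (hA : ∀ h k : Fin d, A h k = c (((h : ℕ) : ℤ) - ((k : ℕ) : ℤ))) (n : ℤ) :
    ∫ x : AddCircle T, fourier n x * (lowerSymbol hH x : ℂ) ∂haarAddCircle =
      (((1 / (d : ℝ)) * ∑ h : Fin d, ∑ k : Fin d,
        if n + (((h : ℕ) : ℤ) - ((k : ℕ) : ℤ)) = 0 then (1 : ℝ) else 0 : ℝ) : ℂ) * c (-n) := by
  have : ∀ x : AddCircle T, fourier n x * (lowerSymbol hH x : ℂ) =
      (1 / (d : ℂ)) * ∑ h : Fin d, ∑ k : Fin d,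
        c (((h : ℕ) : ℤ) - ((k : ℕ) : ℤ)) * fourier (n + (((h : ℕ) : ℤ) - ((k : ℕ) : ℤ))) x := by
    intro x
    simp_rw [lowerSymbol_eq, hA, fourier_add (m := n), Finset.mul_sum]
    exact Finset.sum_congr rfl fun h _ => Finset.sum_congr rfl fun k _ => by ring
  simp_rw [this]
  rw [integral_const_mul, integral_finsetSum _ fun h _ => integrable_finsetSum _ fun k _ =>
    (integrable_fourier _).const_mul _]
  simp_rw [integral_finsetSum _ fun k _ => (integrable_fourier _).const_mul _,
    integral_const_mul, integral_fourier]
  push_cast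
  rw [mul_assoc]
  simp_rw [Finset.sum_mul]
  congr 1
  refine Finset.sum_congr rfl fun h _ => Finset.sum_congr rfl fun k _ => ?_
  split_ifs with hn
  · rw [mul_one, Complex.ofReal_one, one_mul]
    congr 1
    omega
  · simp

end

section

variable {T : ℝ} [hT : Fact (0 < T)] {d : ℕ}

theorem Integrable.mul_norm_trigPoly_sq {G : AddCircle T → ℝ} (hG : Integrable G haarAddCircle)
    (v : Fin d → ℂ) : Integrable (fun x => G x * ‖trigPoly v x‖ ^ 2) haarAddCircle := by
  obtain ⟨C, hC⟩ := isCompact_univ.exists_bound_of_continuousOn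
    ((continuous_trigPoly (T := T) v).norm.pow 2).continuousOn
  exact hG.mul_bdd ((continuous_trigPoly v).norm.pow 2).aestronglyMeasurable
    (Eventually.of_forall fun x => hC x (Set.mem_univ x))

/-- Upper bound: Jensen's inequality for the probability densities given by the eigenvectors. -/
theorem sum_eigenvalues_rpow_le {A : Matrix (Fin d) (Fin d) ℂ} (hP : A.PosSemidef)
    {F : AddCircle T → ℝ} (hF0 : ∀ x, 0 ≤ F x) (hF : Integrable F haarAddCircle) {α : ℝ}
    (hα : 1 < α) (hFα : Integrable (fun x => F x ^ α) haarAddCircle)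
    (hA : ∀ h k : Fin d, A h k =
      fourierCoeff (fun x => (F x : ℂ)) (((h : ℕ) : ℤ) - ((k : ℕ) : ℤ))) :
    ∑ j, hP.isHermitian.eigenvalues j ^ α ≤ d * ∫ x, F x ^ α ∂haarAddCircle := by
  have hj : ∀ j, hP.isHermitian.eigenvalues j ^ α ≤
      ∫ x, F x ^ α * ‖trigPoly (hP.isHermitian.eigenvectorBasis j) x‖ ^ 2 ∂haarAddCircle := by
    intro j
    set l := hP.isHermitian.eigenvalues j
    set v := hP.isHermitian.eigenvectorBasis j
    have hl0 : 0 ≤ l := hP.eigenvalues_nonneg j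
    have h1 : l = ∫ x, F x * ‖trigPoly v x‖ ^ 2 ∂haarAddCircle :=
      eigenvalues_eq_integral hP.isHermitian hF hA j
    have h2 : ∫ x : AddCircle T, ‖trigPoly v x‖ ^ 2 ∂haarAddCircle = 1 :=
      integral_norm_trigPoly_orthonormalBasis_sq _ j
    have i1 : Integrable (fun x => F x * ‖trigPoly v x‖ ^ 2) haarAddCircle :=
      Integrable.mul_norm_trigPoly_sq hF v
    have i2 : Integrable (fun x : AddCircle T => ‖trigPoly v x‖ ^ 2) haarAddCircle := by
      simpa using Integrable.mul_norm_trigPoly_sq (integrable_const (1 : ℝ)) v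
    have h3 : ∫ x, ((l ^ α - α * l ^ (α - 1) * l) * ‖trigPoly v x‖ ^ 2
        + α * l ^ (α - 1) * (F x * ‖trigPoly v x‖ ^ 2)) ∂haarAddCircle = l ^ α := by
      rw [integral_add (i2.const_mul _) (i1.const_mul _), integral_const_mul, integral_const_mul,
        h2, ← h1]
      ring
    rw [← h3]
    refine integral_mono ((i2.const_mul _).add (i1.const_mul _))
      (Integrable.mul_norm_trigPoly_sq hFα v) fun x => ?_
    have h4 := mul_le_mul_of_nonneg_right (rpow_add_mul_sub_le_rpow hα (hF0 x) hl0)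
      (sq_nonneg ‖trigPoly v x‖)
    refine le_trans (le_of_eq ?_) h4
    ring
  refine (Finset.sum_le_sum fun j _ => hj j).trans (le_of_eq ?_)
  rw [← integral_finsetSum _ fun j _ => Integrable.mul_norm_trigPoly_sq hFα _, ← integral_const_mul]
  simp_rw [← Finset.mul_sum, sum_norm_trigPoly_sq, mul_comm]

/-- Lower bound: Jensen's inequality for the spectral measures. -/
theorem integral_lowerSymbol_rpow_le {A : Matrix (Fin d) (Fin d) ℂ} (hP : A.PosSemidef)
    (hd : 0 < d) {α : ℝ} (hα : 1 < α) :
    ∫ x : AddCircle T, lowerSymbol hP.isHermitian x ^ α ∂haarAddCircle ≤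
      (1 / (d : ℝ)) * ∑ j, hP.isHermitian.eigenvalues j ^ α := by
  have hd' : (d : ℝ) ≠ 0 := by positivity
  have hpt : ∀ x : AddCircle T, lowerSymbol hP.isHermitian x ^ α ≤
      (1 / (d : ℝ)) * ∑ j, hP.isHermitian.eigenvalues j ^ α *
        ‖trigPoly (hP.isHermitian.eigenvectorBasis j) x‖ ^ 2 := by
    intro x
    have h := Real.rpow_arith_mean_le_arith_mean_rpow Finset.univ
      (fun j => (1 / (d : ℝ)) * ‖trigPoly (hP.isHermitian.eigenvectorBasis j) x‖ ^ 2)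
      hP.isHermitian.eigenvalues (fun j _ => by positivity)
      (by rw [← Finset.mul_sum, sum_norm_trigPoly_sq, one_div_mul_cancel hd'])
      (fun j _ => hP.eigenvalues_nonneg j) hα.le
    refine (le_of_eq ?_).trans (h.trans (le_of_eq ?_))
    · rw [lowerSymbol, Finset.mul_sum]
      congr 1
      exact Finset.sum_congr rfl fun j _ => by ring
    · rw [Finset.mul_sum]
      exact Finset.sum_congr rfl fun j _ => by ring
  have hi : ∀ j, Integrable (fun x : AddCircle T => hP.isHermitian.eigenvalues j ^ α *
      ‖trigPoly (hP.isHermitian.eigenvectorBasis j) x‖ ^ 2) haarAddCircle := fun j =>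
    Integrable.mul_norm_trigPoly_sq (integrable_const _) _
  refine (integral_mono ?_ ((integrable_finsetSum _ fun j _ => hi j).const_mul _) hpt).trans
    (le_of_eq ?_)
  · exact ((continuous_lowerSymbol _).rpow_const fun _ =>
      Or.inr (by linarith)).integrable_of_hasCompactSupport (HasCompactSupport.of_compactSpace _)
  · rw [integral_const_mul, integral_finsetSum _ fun j _ => hi j]
    simp_rw [integral_const_mul, integral_norm_trigPoly_orthonormalBasis_sq, mul_one]

/-- Szegő's limit theorem for powers `α > 1` and a nonnegative symbol in `L^α`. -/
theorem tendsto_sum_eigenvalues_toeplitz_rpow {F : AddCircle T → ℝ} (hFm : Measurable F)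
    (hF0 : ∀ x, 0 ≤ F x) {α : ℝ} (hα : 1 < α)
    (hFα : Integrable (fun x => F x ^ α) haarAddCircle)
    {A : (d : ℕ) → Matrix (Fin d) (Fin d) ℂ}
    (hA : ∀ (d : ℕ) (h k : Fin d), A d h k =
      fourierCoeff (fun x => (F x : ℂ)) (((h : ℕ) : ℤ) - ((k : ℕ) : ℤ)))
    (hP : ∀ d, (A d).PosSemidef) :
    Tendsto (fun d : ℕ => (1 / (d : ℝ)) * ∑ j, (hP d).isHermitian.eigenvalues j ^ α) atTop
      (nhds (∫ x, F x ^ α ∂haarAddCircle)) := by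
  have hα0 : 0 < α := by linarith
  have hαne : ENNReal.ofReal α ≠ 0 := by simpa using hα0
  have hFL : MemLp F (ENNReal.ofReal α) haarAddCircle := by
    rw [← integrable_norm_rpow_iff hFm.aestronglyMeasurable hαne ENNReal.ofReal_ne_top,
      ENNReal.toReal_ofReal hα0.le]
    simpa only [Real.norm_of_nonneg (hF0 _)] using hFα
  have hF : Integrable F haarAddCircle := hFL.integrable (by simpa using hα.le)
  let S : (d : ℕ) → AddCircle T → ℝ := fun d => lowerSymbol (hP d).isHermitian
  have hS0 : ∀ d x, 0 ≤ S d x := fun d => lowerSymbol_nonneg (hP d)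
  have hSc : ∀ d, Continuous (S d) := fun d => continuous_lowerSymbol _
  have hSα : ∀ d, Integrable (fun x => S d x ^ α) haarAddCircle := fun d =>
    ((hSc d).rpow_const fun _ => Or.inr hα0.le).integrable_of_hasCompactSupport
      (HasCompactSupport.of_compactSpace _)
  have hSL : ∀ d, MemLp (S d) (ENNReal.ofReal α) haarAddCircle := by
    intro d
    rw [← integrable_norm_rpow_iff (hSc d).aestronglyMeasurable hαne ENNReal.ofReal_ne_top,
      ENNReal.toReal_ofReal hα0.le]
    simpa only [Real.norm_of_nonneg (hS0 d _)] using hSα d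
  have hup : ∀ d : ℕ, 0 < d → (1 / (d : ℝ)) * ∑ j, (hP d).isHermitian.eigenvalues j ^ α ≤
      ∫ x, F x ^ α ∂haarAddCircle := by
    intro d hd
    rw [one_div, inv_mul_le_iff₀ (by positivity)]
    exact sum_eigenvalues_rpow_le (hP d) hF0 hF hα hFα (hA d)
  have hlow : ∀ d : ℕ, 0 < d → ∫ x, S d x ^ α ∂haarAddCircle ≤
      (1 / (d : ℝ)) * ∑ j, (hP d).isHermitian.eigenvalues j ^ α := fun d hd =>
    integral_lowerSymbol_rpow_le (hP d) hd hα
  have hSF : ∀ d, eLpNorm (S (d + 1)) (ENNReal.ofReal α) haarAddCircle ≤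
      eLpNorm F (ENNReal.ofReal α) haarAddCircle := by
    intro d
    rw [(hSL _).eLpNorm_eq_integral_rpow_norm hαne ENNReal.ofReal_ne_top,
      hFL.eLpNorm_eq_integral_rpow_norm hαne ENNReal.ofReal_ne_top, ENNReal.toReal_ofReal hα0.le]
    simp only [Real.norm_of_nonneg (hF0 _), Real.norm_of_nonneg (hS0 _ _)]
    refine ENNReal.ofReal_le_ofReal (Real.rpow_le_rpow ?_
      ((hlow _ d.succ_pos).trans (hup _ d.succ_pos)) (by positivity))
    exact integral_nonneg fun x => Real.rpow_nonneg (hS0 _ _) _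
  have hconj : α.HolderConjugate (α / (α - 1)) := Real.HolderConjugate.conjExponent hα
  have hq0 : 0 < α / (α - 1) := hconj.symm.pos
  have : (ENNReal.ofReal (α / (α - 1))).HolderConjugate (ENNReal.ofReal α) :=
    hconj.symm.ennrealOfReal
  let W : ℕ → AddCircle T → ℂ := fun d x => ((S (d + 1) x - F x : ℝ) : ℂ)
  have hGL : MemLp (fun x => ((F x ^ (α - 1) : ℝ) : ℂ)) (ENNReal.ofReal (α / (α - 1)))
      haarAddCircle := by
    refine MemLp.ofReal (f := fun x => F x ^ (α - 1)) ?_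
    rw [← integrable_norm_rpow_iff (hFm.pow_const _).aestronglyMeasurable (by simpa using hq0)
      ENNReal.ofReal_ne_top, ENNReal.toReal_ofReal hq0.le]
    refine hFα.congr (Eventually.of_forall fun x => ?_)
    simp only
    rw [Real.norm_of_nonneg (Real.rpow_nonneg (hF0 x) _), ← Real.rpow_mul (hF0 x),
      mul_div_cancel₀ _ (by linarith : α - 1 ≠ 0)]
  have hweak : Tendsto (fun d => ∫ x, ((F x ^ (α - 1) : ℝ) : ℂ) * W d x ∂haarAddCircle) atTop
      (nhds 0) := by
    refine tendsto_integral_mul_of_tendsto_fourier ENNReal.ofReal_ne_top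
      (p := ENNReal.ofReal α) (W := W)
      (C := eLpNorm F (ENNReal.ofReal α) haarAddCircle + eLpNorm F (ENNReal.ofReal α) haarAddCircle)
      (fun d => ((hSL (d + 1)).sub hFL).ofReal)
      (ENNReal.add_ne_top.2 ⟨hFL.2.ne, hFL.2.ne⟩) (fun d => ?_) (fun n => ?_) hGL
    · have h1 : eLpNorm (W d) (ENNReal.ofReal α) haarAddCircle
          = eLpNorm (S (d + 1) - F) (ENNReal.ofReal α) haarAddCircle :=
        eLpNorm_congr_norm_ae (Eventually.of_forall fun x => by
            simp only [W, Complex.norm_real, Pi.sub_apply])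
      rw [h1]
      exact (eLpNorm_sub_le (hSL _).1 hFL.1 (by simpa using hα.le)).trans
        (add_le_add (hSF d) le_rfl)
    · have h1 : ∀ d, ∫ x, fourier n x * W d x ∂haarAddCircle =
          (((1 / ((d + 1 : ℕ) : ℝ)) * ∑ h : Fin (d + 1), ∑ k : Fin (d + 1),
            if n + (((h : ℕ) : ℤ) - ((k : ℕ) : ℤ)) = 0 then (1 : ℝ) else 0 : ℝ) : ℂ) *
            fourierCoeff (fun x => (F x : ℂ)) (-n) - fourierCoeff (fun x => (F x : ℂ)) (-n) := by
        intro d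
        rw [← integral_fourier_mul_lowerSymbol (T := T) (hP (d + 1)).isHermitian (hA (d + 1)),
          fourierCoeff_neg_eq_integral]
        change _ = ∫ x, fourier n x * (S (d + 1) x : ℂ) ∂haarAddCircle - _
        have i1 : Integrable (fun x => fourier n x * (S (d + 1) x : ℂ)) haarAddCircle :=
          Integrable.fourier_mul ((hSL (d + 1)).integrable (by simpa using hα.le)).ofReal n
        have i2 : Integrable (fun x => fourier n x * (F x : ℂ)) haarAddCircle :=
          Integrable.fourier_mul hF.ofReal n
        rw [← integral_sub i1 i2]
        refine integral_congr_ae (Eventually.of_forall fun x => ?_)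
        simp only [W, S, Complex.ofReal_sub, mul_sub]
      simp_rw [h1]
      have h2 := (Complex.continuous_ofReal.tendsto 1).comp
        ((tendsto_card_diagonal_div n).comp (tendsto_add_atTop_nat 1))
      simpa using (h2.mul_const (fourierCoeff (fun x => (F x : ℂ)) (-n))).sub_const
        (fourierCoeff (fun x => (F x : ℂ)) (-n))
  have hweak' : Tendsto (fun d => ∫ x, F x ^ (α - 1) * (S (d + 1) x - F x) ∂haarAddCircle) atTop
      (nhds 0) := by
    have h := (Complex.continuous_re.tendsto 0).comp hweak
    rw [Complex.zero_re] at h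
    refine h.congr fun d => ?_
    simp only [Function.comp_apply, W, ← Complex.ofReal_mul]
    rw [integral_complex_ofReal, Complex.ofReal_re]
  have hGW : ∀ d, Integrable (fun x => F x ^ (α - 1) * (S (d + 1) x - F x)) haarAddCircle := by
    intro d
    have h := (hGL.integrable_mul (((hSL (d + 1)).sub hFL).ofReal (K := ℂ))).re
    refine h.congr (Eventually.of_forall fun x => ?_)
    simp
  have hlow' : ∀ d, ∫ x, F x ^ α ∂haarAddCircle +
      α * ∫ x, F x ^ (α - 1) * (S (d + 1) x - F x) ∂haarAddCircle ≤
      ∫ x, S (d + 1) x ^ α ∂haarAddCircle := by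
    intro d
    rw [← integral_const_mul, ← integral_add hFα ((hGW d).const_mul _)]
    refine integral_mono (hFα.add ((hGW d).const_mul _)) (hSα _) fun x => ?_
    have := rpow_add_mul_sub_le_rpow hα (hS0 (d + 1) x) (hF0 x)
    simpa only [mul_assoc] using this
  rw [← tendsto_add_atTop_iff_nat 1]
  refine tendsto_of_tendsto_of_tendsto_of_le_of_le (g := fun d => ∫ x, F x ^ α ∂haarAddCircle +
      α * ∫ x, F x ^ (α - 1) * (S (d + 1) x - F x) ∂haarAddCircle) ?_ tendsto_const_nhds
      (fun d => (hlow' d).trans (hlow _ d.succ_pos)) (fun d => hup _ d.succ_pos)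
  simpa using (hweak'.const_mul α).const_add (∫ x, F x ^ α ∂haarAddCircle)

end

section

variable {T : ℝ} [hT : Fact (0 < T)]

theorem measurable_liftIoc {a : ℝ} {f : ℝ → ℝ} (hf : Measurable f) :
    Measurable (liftIoc T a f) :=
  (hf.comp measurable_subtype_coe).comp (measurableEquivIoc T a).measurable

theorem integral_liftIoc_haarAddCircle {a : ℝ} (f : ℝ → ℝ) :
    ∫ x, liftIoc T a f x ∂haarAddCircle = T⁻¹ * ∫ x in a..a + T, f x := by
  rw [integral_haarAddCircle, integral_liftIoc_eq_intervalIntegral, smul_eq_mul]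

theorem integrable_liftIoc_haarAddCircle {a : ℝ} {f : ℝ → ℝ}
    (hf : IntegrableOn f (Set.Ioc a (a + T))) : Integrable (liftIoc T a f) haarAddCircle := by
  have h : MemLp (fun x => (f x : ℂ)) 1 (volume.restrict (Set.Ioc a (a + T))) :=
    (memLp_one_iff_integrable.2 hf).ofReal
  exact (memLp_one_iff_integrable.1 h.memLp_liftIoc.haarAddCircle).re

theorem liftIoc_nonneg {a : ℝ} {f : ℝ → ℝ} (hf : ∀ x ∈ Set.Ioc a (a + T), 0 ≤ f x)
    (x : AddCircle T) : 0 ≤ liftIoc T a f x :=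
  hf _ (equivIoc T a x).2

theorem one_le_integral_rpow {F : AddCircle T → ℝ} (hF0 : ∀ x, 0 ≤ F x)
    (hF : Integrable F haarAddCircle) (hF1 : ∫ x, F x ∂haarAddCircle = 1) {α : ℝ} (hα : 1 < α)
    (hFα : Integrable (fun x => F x ^ α) haarAddCircle) :
    1 ≤ ∫ x, F x ^ α ∂haarAddCircle := by
  have h1 : Integrable (fun x => α * (F x - 1)) haarAddCircle :=
    (hF.sub (integrable_const _)).const_mul _
  calc (1 : ℝ) = ∫ x, (1 + α * (F x - 1)) ∂haarAddCircle := by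
        rw [integral_add (integrable_const _) h1,
          integral_const_mul, integral_sub hF (integrable_const _), hF1]
        simp
    _ ≤ _ := integral_mono ((integrable_const _).add h1) hFα fun x => by
        simpa using rpow_add_mul_sub_le_rpow hα (hF0 x) zero_le_one

end

/-- For a probability density `p` on `[-π, π]` with `∫ p^α < ∞` for some
`α > 1`, the normalized eigenvalue power sums `(1/d) Σ_j λ_j^α` of the Toeplitz matrices
`T_p⁽ᵈ⁾` converge to `(2π)^{α−1} ∫ p^α dφ`; consequently
`(1/(α−1)) log₂((1/d) Tr[(T_p⁽ᵈ⁾)^α]) → log₂(2π) + (1/(α−1)) log₂ ∫ p^α = D_α(p‖u)`. -/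
theorem szego_limit_renyi_power
    (p : ℝ → ℝ) (hp_meas : Measurable p)
    (hp_nonneg : ∀ φ ∈ Set.Icc (-π) π, 0 ≤ p φ)
    (hp_prob : ∫ φ in (-π)..π, p φ = 1)
    (α : ℝ) (hα : 1 < α)
    (hp_int : IntegrableOn (fun φ => p φ ^ α) (Set.Icc (-π) π))
    (T : (d : ℕ) → Matrix (Fin d) (Fin d) ℂ)
    (hT : ∀ (d : ℕ) (h k : Fin d),
      T d h k =
        ∫ φ in (-π)..π, (p φ : ℂ) * Complex.exp (-Complex.I * (((h : ℕ) : ℂ) - ((k : ℕ) : ℂ)) * φ))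
    (hPSD : ∀ d : ℕ, (T d).PosSemidef) :
    Tendsto (fun d : ℕ =>
        (1 / (d : ℝ)) * ∑ j : Fin d, (hPSD d).isHermitian.eigenvalues j ^ α)
      atTop (nhds ((2 * π) ^ (α - 1) * ∫ φ in (-π)..π, p φ ^ α)) ∧
    Tendsto (fun d : ℕ =>
        (1 / (α - 1)) * Real.logb 2
          ((1 / (d : ℝ)) * ∑ j : Fin d, (hPSD d).isHermitian.eigenvalues j ^ α))
      atTop (nhds (Real.logb 2 (2 * π) + (1 / (α - 1)) * Real.logb 2 (∫ φ in (-π)..π, p φ ^ α))) := by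
  have hT2 : Fact (0 < 2 * π) := ⟨Real.two_pi_pos⟩
  have hend : -π + 2 * π = π := by ring
  have hα0 : 0 < α := by linarith
  have hsub : Set.Ioc (-π) (-π + 2 * π) ⊆ Set.Icc (-π) π := by
    rw [hend]
    exact Set.Ioc_subset_Icc_self
  set f : ℝ → ℝ := fun φ => 2 * π * p φ with hf
  set F : AddCircle (2 * π) → ℝ := liftIoc (2 * π) (-π) f with hF
  have hF0 : ∀ x, 0 ≤ F x :=
    liftIoc_nonneg fun φ hφ => mul_nonneg Real.two_pi_pos.le (hp_nonneg φ (hsub hφ))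
  have hfα : ∀ φ ∈ Set.Icc (-π) π, (2 * π) ^ α * p φ ^ α = f φ ^ α := fun φ hφ =>
    (Real.mul_rpow Real.two_pi_pos.le (hp_nonneg φ hφ)).symm
  have hFα : Integrable (fun x => F x ^ α) haarAddCircle := by
    refine integrable_liftIoc_haarAddCircle (f := fun φ => f φ ^ α) ?_
    refine IntegrableOn.congr_fun ?_ (fun φ hφ => hfα φ (hsub hφ)) measurableSet_Ioc
    exact (hp_int.mono_set hsub).const_mul _
  have hFm : Measurable F := measurable_liftIoc (hp_meas.const_mul _)
  have hFint : ∫ x, F x ^ α ∂haarAddCircle = (2 * π) ^ (α - 1) * ∫ φ in (-π)..π, p φ ^ α := by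
    have h := integral_liftIoc_haarAddCircle (T := 2 * π) (a := -π) (fun φ => f φ ^ α)
    rw [hend] at h
    refine h.trans ?_
    have h2 : ∫ φ in (-π)..π, f φ ^ α = ∫ φ in (-π)..π, (2 * π) ^ α * p φ ^ α :=
      intervalIntegral.integral_congr fun φ hφ => by
        rw [Set.uIcc_of_le (by linarith [Real.pi_pos])] at hφ
        exact (hfα φ hφ).symm
    rw [h2, intervalIntegral.integral_const_mul, Real.rpow_sub_one Real.two_pi_pos.ne']
    ring
  have hFone : ∫ x, F x ∂haarAddCircle = 1 := by
    rw [hF, integral_liftIoc_haarAddCircle, hend, hf, intervalIntegral.integral_const_mul, hp_prob,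
      mul_one, inv_mul_cancel₀ Real.two_pi_pos.ne']
  have hFi : Integrable F haarAddCircle := by
    by_contra h
    rw [integral_undef h] at hFone
    exact zero_ne_one hFone
  have hTF : ∀ (d : ℕ) (h k : Fin d), T d h k =
      fourierCoeff (fun x => (F x : ℂ)) (((h : ℕ) : ℤ) - ((k : ℕ) : ℤ)) := by
    intro d h k
    have h1 : (fun x => (F x : ℂ)) = liftIoc (2 * π) (-π) (fun φ => (f φ : ℂ)) := rfl
    rw [hT, h1, fourierCoeff_eq_intervalIntegral _ _ (-π),
      ← intervalIntegral.integral_smul, hend]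
    rw [intervalIntegral.integral_of_le (by linarith [Real.pi_pos]),
      intervalIntegral.integral_of_le (by linarith [Real.pi_pos])]
    refine setIntegral_congr_fun measurableSet_Ioc fun φ hφ => ?_
    have hπ : (π : ℂ) ≠ 0 := Complex.ofReal_ne_zero.2 Real.pi_ne_zero
    rw [liftIoc_coe_apply (by rwa [hend]), fourier_coe_apply, hf, Complex.real_smul, smul_eq_mul]
    have h2 : 2 * (π : ℂ) * Complex.I * ((-(((h : ℕ) : ℤ) - ((k : ℕ) : ℤ)) : ℤ) : ℂ) * (φ : ℂ) /
        ((2 * π : ℝ) : ℂ) = -Complex.I * (((h : ℕ) : ℂ) - ((k : ℕ) : ℂ)) * φ := by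
      push_cast
      field_simp
    rw [h2]
    push_cast
    field_simp
  have hlim := tendsto_sum_eigenvalues_toeplitz_rpow hFm hF0 hα hFα hTF hPSD
  have hone := one_le_integral_rpow hF0 hFi hFone hα hFα
  rw [hFint] at hlim hone
  refine ⟨hlim, ?_⟩
  have hpow : (0 : ℝ) < (2 * π) ^ (α - 1) := Real.rpow_pos_of_pos Real.two_pi_pos _
  have hI : 0 < ∫ φ in (-π)..π, p φ ^ α :=
    pos_of_mul_pos_right (lt_of_lt_of_le one_pos hone) hpow.le
  have hlog : Real.logb 2 (2 * π) + (1 / (α - 1)) * Real.logb 2 (∫ φ in (-π)..π, p φ ^ α) =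
      (1 / (α - 1)) * Real.logb 2 ((2 * π) ^ (α - 1) * ∫ φ in (-π)..π, p φ ^ α) := by
    rw [Real.logb_mul hpow.ne' hI.ne', Real.logb_rpow_eq_mul_logb_of_pos Real.two_pi_pos]
    have : α - 1 ≠ 0 := by linarith
    field_simp
  rw [hlog]
  exact ((Real.continuousAt_logb (mul_pos hpow hI).ne').tendsto.comp hlim).const_mul _
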